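/- For i = 1,2, define β-rows (with coordinates ordered (x₁,x₂,t₁,t₂)): β₁=(0,0,f₂^U,f₁^L), β₂=(0,0,f₂^L,f₁^U), β₃=((f₂^L−f₂^U)w₁, 0, f₂^L−r₁₁(f₂^L−f₂^U)w₁, b₁), β₄=(0,(f₁^L−f₁^U)w₂, b₂, f₁^L−r₂₁(f₁^L−f₁^U)w₂), β₅=((f₂^L−b₂)w₁,(b₁−f₁^U)w₂, b₂−r₁₂(f₂^L−b₂)w₁, b₁−r₂₁(b₁−f₁^U)w₂), β₆=((b₂−f₂^U)w₁,(f₁^L−b₁)w₂, b₂−r₁₁(b₂−f₂^U)w₁, b₁−r₂₂(f₁^L−b₁)w₂), and constants d_k = f₁^U f₂^U − (β_{k1} + β_{k2} + β_{k3} f₁^U + β_{k4} f₂^U) for k = 1,…,6. Then the function g(x₁,x₂,t₁,t₂) = min_{k=1,…,6} (⟨β_k,(x₁,x₂,t₁,t₂)⟩ + d_k) is the concave envelope of the function (x₁,x₂,t₁,t₂) ↦ t₁t₂ over P = P₁×P₂; that is, g ≥ t₁t₂ on P and every concave function h on P with h ≥ t₁t₂ on P satisfies h ≥ g on P. -/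

import Mathlib

/-- Affine function on `ℝ⁴` (coordinates `(x₁, x₂, t₁, t₂)`) with coefficient row
`(a1, a2, a3, a4)` and constant term `d = f₁ᵁ f₂ᵁ − (a1 + a2 + a3 f₁ᵁ + a4 f₂ᵁ)`. -/
noncomputable def affBeta (a1 a2 a3 a4 fU1 fU2 : ℝ) (p : ℝ × ℝ × ℝ × ℝ) : ℝ :=
  a1 * p.1 + a2 * p.2.1 + a3 * p.2.2.1 + a4 * p.2.2.2 +
    (fU1 * fU2 - (a1 + a2 + a3 * fU1 + a4 * fU2))

lemma hull_halfspace (S : Set (ℝ × ℝ)) (A B C : ℝ) (hS : ∀ q ∈ S, A * q.1 + B * q.2 ≤ C)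
    (q : ℝ × ℝ) (hq : q ∈ convexHull ℝ S) : A * q.1 + B * q.2 ≤ C := by
  have hc : Convex ℝ {q : ℝ × ℝ | A * q.1 + B * q.2 ≤ C} := by
    intro y hy z hz α β hα hβ hαβ
    simp only [Set.mem_ofPred_eq, Prod.fst_add, Prod.snd_add, Prod.smul_fst, Prod.smul_snd,
      smul_eq_mul] at *
    obtain rfl : β = 1 - α := by linarith
    nlinarith [mul_le_mul_of_nonneg_left hy hα, mul_le_mul_of_nonneg_left hz hβ]
  exact convexHull_min (fun q hq => hS q hq) hc hq

lemma hull_scale (S : Set (ℝ × ℝ)) (f v θ : ℝ) (h0 : (0, f) ∈ S) (h1 : (v, f) ∈ S)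
    (hθ : 0 ≤ θ) (hθ' : θ ≤ 1) : (θ * v, f) ∈ convexHull ℝ S := by
  have := (convex_convexHull ℝ S) (subset_convexHull ℝ S h0) (subset_convexHull ℝ S h1)
    (sub_nonneg.2 hθ') hθ (by ring)
  convert this using 1
  ext
  · simp
  · simp; ring

set_option maxHeartbeats 1000000 in
/-- Structure of one pentagon: the slack coordinates `a`, `c` and a spread-out
representation of each of its points by points at the three levels `fL`, `b`, `fU`. -/
lemma pentagon_structure (fL fU b p1 p2 r1 r2 w x t : ℝ)
    (hb : fL < b) (hb' : b < fU) (hp1 : 0 ≤ p1) (hp : p1 < p2) (hp2 : p2 ≤ 1)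
    (hconv : (b - fL) / (p2 - p1) < (fU - b) / (1 - p2))
    (hr1 : r1 = (p2 - p1) / (b - fL)) (hr2 : r2 = (1 - p2) / (fU - b))
    (hw : w = 1 / (r1 - r2)) (Q : Set (ℝ × ℝ))
    (hQ : Q = convexHull ℝ ({(0, fL), (p1, fL), (p2, b), (1, fU), (0, fU)} : Set (ℝ × ℝ)))
    (hx : (x, t) ∈ Q) :
    ∃ a c s u xL xU : ℝ, a = fU - b - w * (x - 1 - r1 * (t - fU)) ∧
      c = - (w * (x - 1 - r2 * (t - fU))) ∧ 0 ≤ a ∧ 0 ≤ c ∧ t = b + a - c ∧ fL ≤ t ∧ t ≤ fU ∧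
      0 ≤ u ∧ u ≤ s ∧ s ≤ 1 ∧ t = fL + (b - fL) * s + (fU - b) * u ∧
      x = (1 - s) * xL + (s - u) * p2 + u * xU ∧
      (xL, fL) ∈ Q ∧ (p2, b) ∈ Q ∧ (xU, fU) ∈ Q ∧
      (s = u ∨ (a = u * (fU - b) ∧ c = (1 - s) * (b - fL))) := by
  subst hQ
  have hp2' : p2 < 1 := by
    rcases hp2.lt_or_eq with h | h
    · exact h
    · have : 0 < (b - fL) / (p2 - p1) := div_pos (by linarith) (by linarith)
      rw [show 1 - p2 = 0 by linarith, div_zero] at hconv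
      linarith
  have hB : 0 < b - fL := by linarith
  have hF : 0 < fU - b := by linarith
  have hr : r2 < r1 := by
    rw [div_lt_div_iff₀ (by linarith) (by linarith)] at hconv
    rw [hr1, hr2, div_lt_div_iff₀ hF hB]
    linarith
  have e1 : p2 = p1 + r1 * (b - fL) := by rw [hr1]; field_simp; ring
  have e2 : 1 = p2 + r2 * (fU - b) := by rw [hr2]; field_simp; ring
  have hw0 : 0 < w := by rw [hw]; exact one_div_pos.2 (by linarith)
  have e3 : w * (r1 - r2) = 1 := by rw [hw]; field_simp [(sub_pos.2 hr).ne']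
  have hr10 : 0 < r1 := by rw [hr1]; exact div_pos (by linarith) hB
  have hr20 : 0 < r2 := by rw [hr2]; exact div_pos (by linarith) hF
  have hs := fun A B C h => hull_halfspace _ A B C h _ hx
  simp only [Set.mem_insert_iff, Set.mem_singleton_iff, forall_eq_or_imp, forall_eq] at hs
  have m1 : 0 < (r1 - r2) * (fU - b) := mul_pos (by linarith) hF
  have m2 : 0 < (r1 - r2) * (b - fL) := mul_pos (by linarith) hB
  have m3 : 0 < r1 * (b - fL) := mul_pos hr10 hB
  have m4 : 0 < r2 * (fU - b) := mul_pos hr20 hF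
  have htL : fL ≤ t := by
    have := hs 0 (-1) (-fL) (by refine ⟨?_, ?_, ?_, ?_, ?_⟩ <;> linarith)
    linarith
  have htU : t ≤ fU := by
    have := hs 0 1 fU (by refine ⟨?_, ?_, ?_, ?_, ?_⟩ <;> linarith)
    linarith
  have hx0 : 0 ≤ x := by
    have := hs (-1) 0 0 (by refine ⟨?_, ?_, ?_, ?_, ?_⟩ <;> linarith)
    linarith
  have hA : 0 ≤ p1 + r1 * (t - fL) - x := by
    have := hs 1 (-r1) (p1 - r1 * fL) (by refine ⟨?_, ?_, ?_, ?_, ?_⟩ <;> nlinarith)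
    linarith
  have hC : 0 ≤ 1 + r2 * (t - fU) - x := by
    have := hs 1 (-r2) (1 - r2 * fU) (by refine ⟨?_, ?_, ?_, ?_, ?_⟩ <;> nlinarith)
    linarith
  obtain ⟨a, ha⟩ : ∃ a, a = w * (p1 + r1 * (t - fL) - x) := ⟨_, rfl⟩
  obtain ⟨c, hc⟩ : ∃ c, c = w * (1 + r2 * (t - fU) - x) := ⟨_, rfl⟩
  have ha0 : 0 ≤ a := by rw [ha]; exact mul_nonneg hw0.le hA
  have hc0 : 0 ≤ c := by rw [hc]; exact mul_nonneg hw0.le hC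
  have ht : t = b + a - c := by
    linear_combination (-1) * ha + hc + (b - t) * e3 + w * e1 + w * e2
  have mem : ∀ q ∈ ({(0, fL), (p1, fL), (p2, b), (1, fU), (0, fU)} : Set (ℝ × ℝ)),
      q ∈ convexHull ℝ ({(0, fL), (p1, fL), (p2, b), (1, fU), (0, fU)} : Set (ℝ × ℝ)) :=
    fun q hq => subset_convexHull ℝ _ hq
  by_cases hsu : a / (fU - b) ≤ 1 - c / (b - fL)
  · refine ⟨a, c, 1 - c / (b - fL), a / (fU - b), p1, 1, ?_, ?_, ha0, hc0, ht, htL, htU,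
      by positivity, hsu, ?_, ?_, ?_, mem _ (by simp), mem _ (by simp), mem _ (by simp),
      Or.inr ⟨?_, ?_⟩⟩
    · linear_combination ha + (fU - b) * e3 - w * e1 - w * e2
    · linear_combination hc
    · have : 0 ≤ c / (b - fL) := by positivity
      linarith
    · field_simp
      linear_combination ht
    · obtain ⟨s, hs'⟩ : ∃ s, s = 1 - c / (b - fL) := ⟨_, rfl⟩
      obtain ⟨u, hu'⟩ : ∃ u, u = a / (fU - b) := ⟨_, rfl⟩
      rw [← hs', ← hu']
      have k1 : a = u * (fU - b) := by rw [hu']; field_simp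
      have k2 : c = (1 - s) * (b - fL) := by rw [hs']; field_simp; ring
      have k3 : x = p1 + r1 * (t - fL) - (r1 - r2) * a := by
        rw [ha]; linear_combination (p1 + r1 * (t - fL) - x) * e3
      rw [k3]
      have k4 : t = b + u * (fU - b) - (1 - s) * (b - fL) := by rw [ht, k1, k2]
      rw [k4, k1]
      linear_combination (-s) * e1 - u * e2
    · field_simp
    · field_simp
      ring
  · push Not at hsu
    have hFL : 0 < fU - fL := by linarith
    obtain ⟨u, hu⟩ : ∃ u, u = (t - fL) / (fU - fL) := ⟨_, rfl⟩
    have hu0 : 0 ≤ u := by rw [hu]; exact div_nonneg (by linarith) hFL.le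
    have hu1 : u ≤ 1 := by rw [hu, div_le_one hFL]; linarith
    have htu : t = fL + u * (fU - fL) := by rw [hu]; field_simp; ring
    have hlt : u * (fU - b) ≤ a := by
      have h1 : 1 - c / (b - fL) < a / (fU - b) := hsu
      rw [lt_div_iff₀ hF] at h1
      have h2 : c = (c / (b - fL)) * (b - fL) := by field_simp
      generalize c / (b - fL) = d at h1 h2
      by_contra hcon
      push Not at hcon
      have h3 : d * (b - fL) < (1 - u) * (b - fL) := by linarith
      have h4 : d < 1 - u := lt_of_mul_lt_mul_right h3 hB.le
      have h5 : u * (fU - b) < (1 - d) * (fU - b) := mul_lt_mul_of_pos_right (by linarith) hF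
      linarith
    have hxX : x ≤ (1 - u) * p1 + u := by
      have k3 : x = p1 + r1 * (t - fL) - (r1 - r2) * a := by
        rw [ha]; linear_combination (p1 + r1 * (t - fL) - x) * e3
      have k5 : (r1 - r2) * (u * (fU - b)) ≤ (r1 - r2) * a :=
        mul_le_mul_of_nonneg_left hlt (by linarith)
      have k6 : (1 - u) * p1 + u = p1 + r1 * (t - fL) - (r1 - r2) * (u * (fU - b)) := by
        rw [htu]; linear_combination u * e1 + u * e2
      linarith
    obtain ⟨θ, hθ0, hθ1, hθ⟩ : ∃ θ, 0 ≤ θ ∧ θ ≤ 1 ∧ x = θ * ((1 - u) * p1 + u) := by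
      rcases (hx0.trans hxX).eq_or_lt with h | h
      · exact ⟨0, le_rfl, zero_le_one, by linarith⟩
      · exact ⟨x / ((1 - u) * p1 + u), div_nonneg hx0 h.le, (div_le_one h).2 hxX,
          by field_simp⟩
    refine ⟨a, c, u, u, θ * p1, θ * 1, ?_, ?_, ha0, hc0, ht, htL, htU,
      hu0, le_rfl, hu1, ?_, ?_, hull_scale _ _ _ _ (by simp) (by simp) hθ0 hθ1, mem _ (by simp),
      hull_scale _ _ _ _ (by simp) (by simp) hθ0 hθ1, Or.inl rfl⟩
    · linear_combination ha + (fU - b) * e3 - w * e1 - w * e2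
    · linear_combination hc
    · rw [htu]; ring
    · rw [hθ]; ring

/-- Jensen's inequality along a chain of five points. -/
lemma chain_jensen (P : Set (ℝ × ℝ × ℝ × ℝ)) (h : ℝ × ℝ × ℝ × ℝ → ℝ) (hh : ConcaveOn ℝ P h)
    (ho : ∀ p ∈ P, p.2.2.1 * p.2.2.2 ≤ h p) (e1 e2 e3 e4 : ℝ)
    (h1 : e1 ≤ 1) (h2 : e2 ≤ e1) (h3 : e3 ≤ e2) (h4 : e4 ≤ e3) (h5 : 0 ≤ e4)
    (q0 q1 q2 q3 q4 p : ℝ × ℝ × ℝ × ℝ) (m0 : q0 ∈ P) (m1 : q1 ∈ P) (m2 : q2 ∈ P) (m3 : q3 ∈ P)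
    (m4 : q4 ∈ P)
    (hp : p = (1 - e1) • q0 + (e1 - e2) • q1 + (e2 - e3) • q2 + (e3 - e4) • q3 + e4 • q4) :
    (1 - e1) * (q0.2.2.1 * q0.2.2.2) + (e1 - e2) * (q1.2.2.1 * q1.2.2.2)
      + (e2 - e3) * (q2.2.2.1 * q2.2.2.2) + (e3 - e4) * (q3.2.2.1 * q3.2.2.2)
      + e4 * (q4.2.2.1 * q4.2.2.2) ≤ h p := by
  have key := hh.le_map_sum (t := Finset.univ)
    (w := ![1 - e1, e1 - e2, e2 - e3, e3 - e4, e4]) (p := ![q0, q1, q2, q3, q4])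
    (by intro i _; fin_cases i <;> simp <;> linarith)
    (by simp [Fin.sum_univ_five])
    (by intro i _; fin_cases i <;> simp <;> assumption)
  simp only [Fin.sum_univ_five, smul_eq_mul, Matrix.cons_val] at key
  rw [← hp] at key
  refine le_trans ?_ key
  gcongr <;> first | linarith | (apply ho; assumption)

set_option maxHeartbeats 2000000 in
/-- The pointwise minimum of the six affine functions `⟨β_k, ·⟩ + d_k` is the concave
envelope of `(x₁,x₂,t₁,t₂) ↦ t₁ t₂` over the product of pentagons `P = P₁ × P₂`. -/
theorem pentagon_product_concave_envelope
    (fL1 fU1 b1 p11 p12 fL2 fU2 b2 p21 p22 : ℝ)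
    (hb1 : fL1 < b1) (hb1' : b1 < fU1) (hb2 : fL2 < b2) (hb2' : b2 < fU2)
    (hp11 : 0 ≤ p11) (hp12 : p11 < p12) (hp13 : p12 ≤ 1)
    (hp21 : 0 ≤ p21) (hp22 : p21 < p22) (hp23 : p22 ≤ 1)
    (hconv1 : (b1 - fL1) / (p12 - p11) < (fU1 - b1) / (1 - p12))
    (hconv2 : (b2 - fL2) / (p22 - p21) < (fU2 - b2) / (1 - p22))
    (r11 r12 w1 r21 r22 w2 : ℝ)
    (hr11 : r11 = (p12 - p11) / (b1 - fL1))
    (hr12 : r12 = (1 - p12) / (fU1 - b1))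
    (hw1 : w1 = 1 / (r11 - r12))
    (hr21 : r21 = (p22 - p21) / (b2 - fL2))
    (hr22 : r22 = (1 - p22) / (fU2 - b2))
    (hw2 : w2 = 1 / (r21 - r22))
    (P1 P2 : Set (ℝ × ℝ))
    (hP1 : P1 = convexHull ℝ ({(0, fL1), (p11, fL1), (p12, b1), (1, fU1), (0, fU1)} : Set (ℝ × ℝ)))
    (hP2 : P2 = convexHull ℝ ({(0, fL2), (p21, fL2), (p22, b2), (1, fU2), (0, fU2)} : Set (ℝ × ℝ)))
    (P : Set (ℝ × ℝ × ℝ × ℝ))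
    (hP : P = {p : ℝ × ℝ × ℝ × ℝ | (p.1, p.2.2.1) ∈ P1 ∧ (p.2.1, p.2.2.2) ∈ P2})
    (g : ℝ × ℝ × ℝ × ℝ → ℝ)
    (hg : ∀ p, g p =
      min (min (min (min (min
        (affBeta 0 0 fU2 fL1 fU1 fU2 p)
        (affBeta 0 0 fL2 fU1 fU1 fU2 p))
        (affBeta ((fL2 - fU2) * w1) 0 (fL2 - r11 * (fL2 - fU2) * w1) b1 fU1 fU2 p))
        (affBeta 0 ((fL1 - fU1) * w2) b2 (fL1 - r21 * (fL1 - fU1) * w2) fU1 fU2 p))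
        (affBeta ((fL2 - b2) * w1) ((b1 - fU1) * w2)
          (b2 - r12 * (fL2 - b2) * w1) (b1 - r21 * (b1 - fU1) * w2) fU1 fU2 p))
        (affBeta ((b2 - fU2) * w1) ((fL1 - b1) * w2)
          (b2 - r11 * (b2 - fU2) * w1) (b1 - r22 * (fL1 - b1) * w2) fU1 fU2 p)) :
    (∀ p ∈ P, p.2.2.1 * p.2.2.2 ≤ g p) ∧
      ∀ h : ℝ × ℝ × ℝ × ℝ → ℝ, ConcaveOn ℝ P h →
        (∀ p ∈ P, p.2.2.1 * p.2.2.2 ≤ h p) → ∀ p ∈ P, g p ≤ h p := by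
  have memP : ∀ x1 x2 t1 t2 : ℝ, (x1, t1) ∈ P1 → (x2, t2) ∈ P2 → (x1, x2, t1, t2) ∈ P := by
    intro x1 x2 t1 t2 k1 k2
    rw [hP]
    exact ⟨k1, k2⟩
  have struct : ∀ x1 x2 t1 t2 : ℝ, (x1, x2, t1, t2) ∈ P → _ ∧ _ := fun x1 x2 t1 t2 hm => by
    rw [hP] at hm
    exact ⟨pentagon_structure fL1 fU1 b1 p11 p12 r11 r12 w1 x1 t1 hb1 hb1' hp11 hp12 hp13 hconv1
      hr11 hr12 hw1 P1 hP1 hm.1, pentagon_structure fL2 fU2 b2 p21 p22 r21 r22 w2 x2 t2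
      hb2 hb2' hp21 hp22 hp23 hconv2 hr21 hr22 hw2 P2 hP2 hm.2⟩
  constructor
  · rintro ⟨x1, x2, t1, t2⟩ hm
    obtain ⟨⟨a1, c1, s1, u1, xL1, xU1, ha1, hc1, ha1p, hc1p, ht1, htL1, htU1, -⟩,
      ⟨a2, c2, s2, u2, xL2, xU2, ha2, hc2, ha2p, hc2p, ht2, htL2, htU2, -⟩⟩ :=
      struct x1 x2 t1 t2 hm
    rw [hg]
    simp only [le_min_iff, affBeta]
    refine ⟨⟨⟨⟨⟨?_, ?_⟩, ?_⟩, ?_⟩, ?_⟩, ?_⟩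
    · linarith [mul_nonneg (sub_nonneg.2 htL1) (sub_nonneg.2 htU2)]
    · linarith [mul_nonneg (sub_nonneg.2 htU1) (sub_nonneg.2 htL2)]
    · have k := add_nonneg (mul_nonneg ha1p (sub_nonneg.2 htU2))
        (mul_nonneg hc1p (sub_nonneg.2 htL2))
      refine le_of_sub_nonneg (k.trans_eq ?_)
      linear_combination (fU2 - fL2) * ha1 + (t2 - fL2) * ht1
    · have k := add_nonneg (mul_nonneg ha2p (sub_nonneg.2 htU1))
        (mul_nonneg hc2p (sub_nonneg.2 htL1))
      refine le_of_sub_nonneg (k.trans_eq ?_)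
      linear_combination (fU1 - fL1) * ha2 + (t1 - fL1) * ht2
    · have k : 0 ≤ c1 * (b2 - fL2) + a2 * (fU1 - b1) - (t1 - b1) * (t2 - b2) := by
        rcases le_total b1 t1 with hb | hb
        · nlinarith [mul_nonneg (sub_nonneg.2 hb) hc2p, mul_nonneg ha2p (sub_nonneg.2 htU1),
            mul_nonneg hc1p (sub_nonneg.2 hb2.le)]
        · nlinarith [mul_nonneg ha1p (sub_nonneg.2 hb2.le), mul_nonneg ha2p (sub_nonneg.2 hb1'.le),
            mul_nonneg (sub_nonneg.2 hb) (sub_nonneg.2 htL2)]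
      refine le_of_sub_nonneg (k.trans_eq ?_)
      linear_combination (b2 - fL2) * hc1 + (fU1 - b1) * ha2
    · have k : 0 ≤ c2 * (b1 - fL1) + a1 * (fU2 - b2) - (t1 - b1) * (t2 - b2) := by
        rcases le_total b2 t2 with hb | hb
        · nlinarith [mul_nonneg (sub_nonneg.2 hb) hc1p, mul_nonneg ha1p (sub_nonneg.2 htU2),
            mul_nonneg hc2p (sub_nonneg.2 hb1.le)]
        · nlinarith [mul_nonneg ha2p (sub_nonneg.2 hb1.le), mul_nonneg ha1p (sub_nonneg.2 hb2'.le),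
            mul_nonneg (sub_nonneg.2 hb) (sub_nonneg.2 htL1)]
      refine le_of_sub_nonneg (k.trans_eq ?_)
      linear_combination (b1 - fL1) * hc2 + (fU2 - b2) * ha1
  · rintro h hh ho ⟨x1, x2, t1, t2⟩ hm
    obtain ⟨⟨a1, c1, s1, u1, xL1, xU1, ha1, hc1, -, -, -, -, -, hu1, hsu1, hs1, ht1, hx1,
      mL1, mb1, mU1, hor1⟩,
      ⟨a2, c2, s2, u2, xL2, xU2, ha2, hc2, -, -, -, -, -, hu2, hsu2, hs2, ht2, hx2,
      mL2, mb2, mU2, hor2⟩⟩ := struct x1 x2 t1 t2 hm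
    have jen := chain_jensen P h hh ho
    rw [hg]
    -- the six affine functions bound the minimum from above
    simp only [min_le_iff, affBeta]
    have LL := memP _ _ _ _ mL1 mL2
    have bL := memP _ _ _ _ mb1 mL2
    have UL := memP _ _ _ _ mU1 mL2
    have Lb := memP _ _ _ _ mL1 mb2
    have bb := memP _ _ _ _ mb1 mb2
    have Ub := memP _ _ _ _ mU1 mb2
    have LU := memP _ _ _ _ mL1 mU2
    have bU := memP _ _ _ _ mb1 mU2
    have UU := memP _ _ _ _ mU1 mU2
    -- chains for the six interleavings of `s1 ≥ u1` and `s2 ≥ u2`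
    have o2 : s2 ≤ u1 → fU1 * t2 + fL2 * t1 - fU1 * fL2 ≤ h (x1, x2, t1, t2) := by
      intro hle
      refine le_of_eq_of_le ?_ (jen s1 u1 s2 u2 hs1 hsu1 hle hsu2 hu2 _ _ _ _ _ (x1, x2, t1, t2)
        LL bL UL Ub UU ?_)
      · simp only [ht1, ht2]; ring
      · simp only [Prod.smul_mk, Prod.mk_add_mk, smul_eq_mul, ht1, ht2, hx1, hx2, Prod.mk.injEq]
        refine ⟨?_, ?_, ?_, ?_⟩ <;> ring
    have o1 : s1 ≤ u2 → fU2 * t1 + fL1 * t2 - fU2 * fL1 ≤ h (x1, x2, t1, t2) := by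
      intro hle
      refine le_of_eq_of_le ?_ (jen s2 u2 s1 u1 hs2 hsu2 hle hsu1 hu1 _ _ _ _ _ (x1, x2, t1, t2)
        LL Lb LU bU UU ?_)
      · simp only [ht1, ht2]; ring
      · simp only [Prod.smul_mk, Prod.mk_add_mk, smul_eq_mul, ht1, ht2, hx1, hx2, Prod.mk.injEq]
        refine ⟨?_, ?_, ?_, ?_⟩ <;> ring
    have o3 : s2 ≤ s1 → u1 ≤ u2 → (fU2 - fL2) * (u1 * (fU1 - b1) - (fU1 - b1)) + fL2 * (t1 - fU1)
        + b1 * (t2 - fU2) + fU1 * fU2 ≤ h (x1, x2, t1, t2) := by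
      intro hle hle'
      refine le_of_eq_of_le ?_ (jen s1 s2 u2 u1 hs1 hle hsu2 hle' hu1 _ _ _ _ _ (x1, x2, t1, t2)
        LL bL bb bU UU ?_)
      · simp only [ht1, ht2]; ring
      · simp only [Prod.smul_mk, Prod.mk_add_mk, smul_eq_mul, ht1, ht2, hx1, hx2, Prod.mk.injEq]
        refine ⟨?_, ?_, ?_, ?_⟩ <;> ring
    have o4 : s1 ≤ s2 → u2 ≤ u1 → (fU1 - fL1) * (u2 * (fU2 - b2) - (fU2 - b2)) + fL1 * (t2 - fU2)
        + b2 * (t1 - fU1) + fU1 * fU2 ≤ h (x1, x2, t1, t2) := by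
      intro hle hle'
      refine le_of_eq_of_le ?_ (jen s2 s1 u1 u2 hs2 hle hsu1 hle' hu2 _ _ _ _ _ (x1, x2, t1, t2)
        LL Lb bb Ub UU ?_)
      · simp only [ht1, ht2]; ring
      · simp only [Prod.smul_mk, Prod.mk_add_mk, smul_eq_mul, ht1, ht2, hx1, hx2, Prod.mk.injEq]
        refine ⟨?_, ?_, ?_, ?_⟩ <;> ring
    have o56 : (s2 ≤ s1 → u1 ≤ s2 → u2 ≤ u1 → (b2 - fL2) * ((1 - s1) * (b1 - fL1))
          + (fU1 - b1) * (u2 * (fU2 - b2) - (fU2 - b2)) + b2 * (t1 - fU1) + b1 * (t2 - fU2)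
          + fU1 * fU2 ≤ h (x1, x2, t1, t2)) ∧
        (s1 ≤ s2 → u2 ≤ s1 → u1 ≤ u2 → (b1 - fL1) * ((1 - s2) * (b2 - fL2))
          + (fU2 - b2) * (u1 * (fU1 - b1) - (fU1 - b1)) + b2 * (t1 - fU1) + b1 * (t2 - fU2)
          + fU1 * fU2 ≤ h (x1, x2, t1, t2)) := by
      refine ⟨fun k1 k2 k3 => ?_, fun k1 k2 k3 => ?_⟩
      · refine le_of_eq_of_le ?_ (jen s1 s2 u1 u2 hs1 k1 k2 k3 hu2 _ _ _ _ _ (x1, x2, t1, t2)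
          LL bL bb Ub UU ?_)
        · simp only [ht1, ht2]; ring
        · simp only [Prod.smul_mk, Prod.mk_add_mk, smul_eq_mul, ht1, ht2, hx1, hx2, Prod.mk.injEq]
          refine ⟨?_, ?_, ?_, ?_⟩ <;> ring
      · refine le_of_eq_of_le ?_ (jen s2 s1 u2 u1 hs2 k1 k2 k3 hu1 _ _ _ _ _ (x1, x2, t1, t2)
          LL Lb bb bU UU ?_)
        · simp only [ht1, ht2]; ring
        · simp only [Prod.smul_mk, Prod.mk_add_mk, smul_eq_mul, ht1, ht2, hx1, hx2, Prod.mk.injEq]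
          refine ⟨?_, ?_, ?_, ?_⟩ <;> ring
    rcases le_total s1 u2 with k1 | k1
    · iterate 5 left
      linarith [o1 k1]
    rcases le_total s2 u1 with k2 | k2
    · iterate 4 left
      right
      linarith [o2 k2]
    rcases le_total s1 s2 with k3 | k3 <;> rcases le_total u1 u2 with k4 | k4
    · -- order s2 s1 u2 u1: function 6
      rcases hor1 with e | ⟨ea1, ec1⟩
      · iterate 5 left
        linarith [o1 (by linarith)]
      rcases hor2 with e | ⟨ea2, ec2⟩
      · iterate 5 left
        linarith [o1 (by linarith)]
      right
      refine le_of_eq_of_le ?_ (o56.2 k3 k1 k4)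
      rw [← ea1, ← ec2]
      linear_combination (-(fU2 - b2)) * ha1 - (b1 - fL1) * hc2
    · -- order s2 s1 u1 u2: function 4
      rcases hor2 with e | ⟨ea2, ec2⟩
      · iterate 4 left
        right
        linarith [o2 (by linarith)]
      iterate 2 left
      right
      refine le_of_eq_of_le ?_ (o4 k3 k4)
      rw [← ea2]
      linear_combination (-(fU1 - fL1)) * ha2
    · -- order s1 s2 u2 u1: function 3
      rcases hor1 with e | ⟨ea1, ec1⟩
      · iterate 5 left
        linarith [o1 (by linarith)]
      iterate 3 left
      right
      refine le_of_eq_of_le ?_ (o3 k3 k4)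
      rw [← ea1]
      linear_combination (-(fU2 - fL2)) * ha1
    · -- order s1 s2 u1 u2: function 5
      rcases hor1 with e | ⟨ea1, ec1⟩
      · iterate 4 left
        right
        linarith [o2 (by linarith)]
      rcases hor2 with e | ⟨ea2, ec2⟩
      · iterate 4 left
        right
        linarith [o2 (by linarith)]
      left
      right
      refine le_of_eq_of_le ?_ (o56.1 k3 k2 k4)
      rw [← ea2, ← ec1]
      linear_combination (-(fU1 - b1)) * ha2 - (b2 - fL2) * hc1
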